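/- For q(θ) = N(θ; μ, S) with v = S⁻¹(θ−μ) and V = (θ−μ)(θ−μ)ᵀ, the gradient of log q with respect to the expectation parameter m₁ = μ is ∇_{m₁} log q(θ) = S⁻¹(θ − V S⁻¹ μ) = S⁻¹θ − v vᵀ μ. -/

import Mathlib

open Matrix

attribute [local instance] Matrix.normedAddCommGroup Matrix.normedSpace

/-- The continuous linear map `x ↦ ⟪g, x⟫` on `ℝ^d`, representing a gradient. -/
noncomputable def dotCLM {d : ℕ} (g : Fin d → ℝ) : (Fin d → ℝ) →L[ℝ] ℝ :=
  LinearMap.toContinuousLinearMap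
    { toFun := fun x => ∑ i, g i * x i
      map_add' := fun x y => by simp [mul_add, Finset.sum_add_distrib]
      map_smul' := fun c x => by simp [Finset.mul_sum, mul_left_comm] }

/-- The continuous linear map `H ↦ ∑ᵢⱼ Gᵢⱼ Hᵢⱼ`, a matrix gradient under the
Frobenius pairing. -/
noncomputable def matCLM {d : ℕ} (G : Matrix (Fin d) (Fin d) ℝ) :
    Matrix (Fin d) (Fin d) ℝ →L[ℝ] ℝ :=
  LinearMap.toContinuousLinearMap
    { toFun := fun H => ∑ i, ∑ j, G i j * H i j
      map_add' := fun x y => by simp [mul_add, Finset.sum_add_distrib]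
      map_smul' := fun c x => by simp [Finset.mul_sum, mul_left_comm] }

/-- A joint gradient `(gμ, gS)` on the product space `ℝ^d × Matrix d d ℝ`. -/
noncomputable def pairCLM {d : ℕ} (gμ : Fin d → ℝ) (gS : Matrix (Fin d) (Fin d) ℝ) :
    ((Fin d → ℝ) × Matrix (Fin d) (Fin d) ℝ) →L[ℝ] ℝ :=
  (dotCLM gμ).comp (ContinuousLinearMap.fst ℝ _ _)
    + (matCLM gS).comp (ContinuousLinearMap.snd ℝ _ _)

/-- The multivariate Gaussian density `N(θ; μ, S)`. -/
noncomputable def gaussianPdf {d : ℕ} (μ : Fin d → ℝ) (S : Matrix (Fin d) (Fin d) ℝ)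
    (θ : Fin d → ℝ) : ℝ :=
  (2 * Real.pi) ^ (-(d : ℝ) / 2) * S.det ^ (-(1 : ℝ) / 2) *
    Real.exp (-(1 / 2) * dotProduct (θ - μ) (S⁻¹ *ᵥ (θ - μ)))

theorem ringInverse_hasFDerivAt_aux {R : Type*} [NormedRing R] [NormedAlgebra ℝ R]
    [FiniteDimensional ℝ R] (u : Rˣ) :
    HasFDerivAt (Ring.inverse : R → R)
      (-ContinuousLinearMap.mulLeftRight ℝ R (u⁻¹ : Rˣ) (u⁻¹ : Rˣ)) u := by
  have : CompleteSpace R := FiniteDimensional.complete ℝ R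
  exact hasFDerivAt_ringInverse (𝕜 := ℝ) u

section InvDeriv

attribute [local instance] Matrix.linftyOpNormedRing Matrix.linftyOpNormedAlgebra

theorem inv_hasFDerivAt_aux {d : ℕ} (S : Matrix (Fin d) (Fin d) ℝ) (hS : IsUnit S) :
    ∃ L : Matrix (Fin d) (Fin d) ℝ →L[ℝ] Matrix (Fin d) (Fin d) ℝ,
      HasFDerivAt (fun A : Matrix (Fin d) (Fin d) ℝ => A⁻¹) L S ∧
      ∀ H, L H = -(S⁻¹ * H * S⁻¹) := by
  obtain ⟨u, rfl⟩ := hS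
  have h := ringInverse_hasFDerivAt_aux u
  have e : (Ring.inverse : Matrix (Fin d) (Fin d) ℝ → _) = fun A => A⁻¹ := by
    funext A; exact (Matrix.nonsing_inv_eq_ringInverse A).symm
  rw [e] at h
  refine ⟨_, h, ?_⟩
  intro H
  rw [← Matrix.coe_units_inv]
  rfl

end InvDeriv

theorem inv_hasFDerivAt {d : ℕ} (S : Matrix (Fin d) (Fin d) ℝ) (hS : IsUnit S) :
    ∃ L : Matrix (Fin d) (Fin d) ℝ →L[ℝ] Matrix (Fin d) (Fin d) ℝ,
      HasFDerivAt (fun A : Matrix (Fin d) (Fin d) ℝ => A⁻¹) L S ∧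
      ∀ H, L H = -(S⁻¹ * H * S⁻¹) := inv_hasFDerivAt_aux S hS

theorem det_hasFDerivAt {d : ℕ} (S : Matrix (Fin d) (Fin d) ℝ) :
    HasFDerivAt (fun A : Matrix (Fin d) (Fin d) ℝ => A.det) (matCLM S.adjugateᵀ) S := by
  let f : ContinuousMultilinearMap ℝ (fun _ : Fin d => Fin d → ℝ) ℝ :=
    { (Matrix.detRowAlternating (n := Fin d) (R := ℝ)).toMultilinearMap with
      cont := by
        change Continuous (fun A : Matrix (Fin d) (Fin d) ℝ => A.det)
        exact continuous_id.matrix_det }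
  have h := f.hasFDerivAt S
  refine HasFDerivAt.congr_fderiv (f := fun A : Matrix (Fin d) (Fin d) ℝ => A.det) h ?_
  apply ContinuousLinearMap.ext
  intro H
  have h1 : f.linearDeriv S H = ∑ i, (S.updateRow i (H i)).det := by
    exact ContinuousMultilinearMap.linearDeriv_apply f S H
  refine h1.trans ?_
  change _ = ∑ i, ∑ j, S.adjugateᵀ i j * H i j
  refine Finset.sum_congr rfl fun i _ => ?_
  rw [← cramer_transpose_apply, cramer_eq_adjugate_mulVec, adjugate_transpose]
  rfl

theorem dotCLM_apply' {d : ℕ} (g x : Fin d → ℝ) : dotCLM g x = g ⬝ᵥ x := rfl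

theorem matCLM_apply' {d : ℕ} (G H : Matrix (Fin d) (Fin d) ℝ) :
    matCLM G H = ∑ i, ∑ j, G i j * H i j := rfl

theorem matCLM_vecMulVec_right {d : ℕ} (G : Matrix (Fin d) (Fin d) ℝ) (a b : Fin d → ℝ) :
    matCLM G (vecMulVec a b) = a ⬝ᵥ G *ᵥ b := by
  simp only [matCLM_apply', dotProduct, mulVec, vecMulVec_apply, Finset.mul_sum]
  exact Finset.sum_congr rfl fun i _ => Finset.sum_congr rfl fun j _ => by ring

theorem matCLM_vecMulVec_left {d : ℕ} (H : Matrix (Fin d) (Fin d) ℝ) (a b : Fin d → ℝ) :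
    matCLM (vecMulVec a b) H = a ⬝ᵥ H *ᵥ b := by
  simp only [matCLM_apply', dotProduct, mulVec, vecMulVec_apply, Finset.mul_sum]
  exact Finset.sum_congr rfl fun i _ => Finset.sum_congr rfl fun j _ => by ring

theorem matCLM_sub_left {d : ℕ} (G G' H : Matrix (Fin d) (Fin d) ℝ) :
    matCLM (G - G') H = matCLM G H - matCLM G' H := by
  simp [matCLM_apply', sub_mul, Finset.sum_sub_distrib]

theorem matCLM_smul_left {d : ℕ} (c : ℝ) (G H : Matrix (Fin d) (Fin d) ℝ) :
    matCLM (c • G) H = c * matCLM G H := by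
  simp [matCLM_apply', Finset.mul_sum, mul_assoc]

/-- Derivative of the quadratic form `r ⬝ᵥ A⁻¹ *ᵥ r`. -/
theorem quad_hasFDerivAt {d : ℕ} {E : Type*} [NormedAddCommGroup E] [NormedSpace ℝ E]
    (r : E → Fin d → ℝ) (B : E → Matrix (Fin d) (Fin d) ℝ) (p : E)
    (r' : E →L[ℝ] (Fin d → ℝ)) (B' : E →L[ℝ] Matrix (Fin d) (Fin d) ℝ)
    (hr : HasFDerivAt r r' p) (hB : HasFDerivAt B B' p) :
    ∃ L : E →L[ℝ] ℝ, HasFDerivAt (fun q => r q ⬝ᵥ B q *ᵥ r q) L p ∧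
      ∀ h, L h = r' h ⬝ᵥ B p *ᵥ r p + r p ⬝ᵥ B' h *ᵥ r p + r p ⬝ᵥ B p *ᵥ r' h := by
  have hri := hasFDerivAt_pi'.1 hr
  have hBi : ∀ i, HasFDerivAt (fun q => B q i) _ p := hasFDerivAt_pi'.1 hB
  have hBij := fun i => hasFDerivAt_pi'.1 (hBi i)
  have hin : ∀ i, HasFDerivAt (fun q => (B q *ᵥ r q) i) _ p := fun i =>
    HasFDerivAt.fun_sum (u := Finset.univ) fun j _ => (hBij i j).fun_mul (hri j)
  have hout : HasFDerivAt (fun q => r q ⬝ᵥ B q *ᵥ r q) _ p :=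
    HasFDerivAt.fun_sum (u := Finset.univ) fun i _ => (hri i).fun_mul (hin i)
  refine ⟨_, hout, ?_⟩
  intro h
  simp only [dotProduct, mulVec, ← Finset.sum_add_distrib, Finset.mul_sum]
  simp [Finset.mul_sum, Finset.sum_mul, ← Finset.sum_add_distrib]
  refine Finset.sum_congr rfl fun i _ => Finset.sum_congr rfl fun j _ => ?_
  change _ = r' h i * (B p i j * r p j) + r p i * (B' h i j * r p j) + r p i * (B p i j * r' h j)
  have e : (ContinuousLinearMap.proj i ∘SL B') h j = B' h i j := rfl
  rw [← e]
  ring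

theorem cov_hasFDerivAt {d : ℕ} (p : (Fin d → ℝ) × Matrix (Fin d) (Fin d) ℝ) :
    ∃ L : ((Fin d → ℝ) × Matrix (Fin d) (Fin d) ℝ) →L[ℝ] Matrix (Fin d) (Fin d) ℝ,
      HasFDerivAt (fun p : (Fin d → ℝ) × Matrix (Fin d) (Fin d) ℝ =>
        p.2 - vecMulVec p.1 p.1) L p ∧
      ∀ h, L h = h.2 - vecMulVec h.1 p.1 - vecMulVec p.1 h.1 := by
  have h1 : HasFDerivAt (fun p : (Fin d → ℝ) × Matrix (Fin d) (Fin d) ℝ => p.1) _ p :=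
    (ContinuousLinearMap.fst ℝ (Fin d → ℝ) (Matrix (Fin d) (Fin d) ℝ)).hasFDerivAt
  have hi := hasFDerivAt_pi'.1 h1
  have h2 : HasFDerivAt (fun p : (Fin d → ℝ) × Matrix (Fin d) (Fin d) ℝ => 
      (vecMulVec p.1 p.1 : Matrix (Fin d) (Fin d) ℝ)) _ p :=
    hasFDerivAt_pi.2 fun i => hasFDerivAt_pi.2 fun j => (hi i).mul (hi j)
  refine ⟨_, (ContinuousLinearMap.snd ℝ (Fin d → ℝ) (Matrix (Fin d) (Fin d) ℝ)).hasFDerivAt.sub h2, ?_⟩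
  intro h
  rw [sub_sub]
  ext i j
  change h.2 i j - (p.1 i * h.1 j + p.1 j * h.1 i) = h.2 i j - (h.1 i * p.1 j + p.1 i * h.1 j)
  ring

/-- For `q(θ) = N(θ; μ, S)` with `v = S⁻¹(θ−μ)` and `V = (θ−μ)(θ−μ)ᵀ`, the
gradient of `log q` with respect to the expectation parameters `m₁ = μ`,
`m₂ = S + μμᵀ` is `∇_{m₁} log q(θ) = S⁻¹θ − v vᵀ μ` (together with
`∇_{m₂} log q(θ) = −½(S⁻¹ − S⁻¹ V S⁻¹)`). -/
theorem grad_expectation_param_log_gaussianPdf {d : ℕ}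
    (S : Matrix (Fin d) (Fin d) ℝ) (hS : S.PosDef) (θ μ : Fin d → ℝ) :
    HasFDerivAt (fun p : (Fin d → ℝ) × Matrix (Fin d) (Fin d) ℝ =>
        Real.log (gaussianPdf p.1 (p.2 - vecMulVec p.1 p.1) θ))
      (pairCLM (S⁻¹ *ᵥ θ - vecMulVec (S⁻¹ *ᵥ (θ - μ)) (S⁻¹ *ᵥ (θ - μ)) *ᵥ μ)
        (-(1 / 2 : ℝ) • (S⁻¹ - S⁻¹ * vecMulVec (θ - μ) (θ - μ) * S⁻¹)))
      (μ, S + vecMulVec μ μ) := by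
  have hdet : 0 < S.det := hS.det_pos
  have hunit : IsUnit S := hS.isUnit
  have hsym : Sᵀ = S := by simpa using hS.isHermitian.eq
  have hWsym : (S⁻¹)ᵀ = S⁻¹ := by rw [transpose_nonsing_inv, hsym]
  obtain ⟨LA, hA, hLA⟩ := cov_hasFDerivAt (μ, S + vecMulVec μ μ)
  obtain ⟨LI, hI, hLI⟩ := inv_hasFDerivAt S hunit
  have hval : (S + vecMulVec μ μ) - vecMulVec μ μ = S := add_sub_cancel_right _ _
  have hI' : HasFDerivAt (fun A : Matrix (Fin d) (Fin d) ℝ => A⁻¹) LI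
      ((S + vecMulVec μ μ) - vecMulVec μ μ) := by rw [hval]; exact hI
  have hD' : HasFDerivAt (fun A : Matrix (Fin d) (Fin d) ℝ => A.det) (matCLM S.adjugateᵀ)
      ((S + vecMulVec μ μ) - vecMulVec μ μ) := by rw [hval]; exact det_hasFDerivAt S
  have hinv := HasFDerivAt.comp (μ, S + vecMulVec μ μ) hI' hA
  have hd := HasFDerivAt.comp (μ, S + vecMulVec μ μ) hD' hA
  have hr : HasFDerivAt (fun p : (Fin d → ℝ) × Matrix (Fin d) (Fin d) ℝ => θ - p.1) _
    (μ, S + vecMulVec μ μ) := 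
      (ContinuousLinearMap.fst ℝ (Fin d → ℝ) (Matrix (Fin d) (Fin d) ℝ)).hasFDerivAt.const_sub θ
  obtain ⟨LQ, hQ, hLQ⟩ := quad_hasFDerivAt _ _ _ _ _ hr hinv
  have hne : ((fun A : Matrix (Fin d) (Fin d) ℝ => A.det) ∘ fun p : (Fin d → ℝ) ×
      Matrix (Fin d) (Fin d) ℝ => p.2 - vecMulVec p.1 p.1) (μ, S + vecMulVec μ μ) ≠ 0 := by
    simp only [Function.comp, hval]; exact hdet.ne'
  have hlog := hd.log hne
  have hpos : ∀ᶠ p in nhds (μ, S + vecMulVec μ μ), 0 < (p.2 - vecMulVec p.1 p.1).det := by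
    refine hd.continuousAt.eventually (lt_mem_nhds ?_)
    simp only [Function.comp, hval]; exact hdet
  have hmain := ((hlog.const_mul (-(1 : ℝ) / 2)).add (hQ.const_mul (-(1 / 2 : ℝ)))).const_add
    (Real.log ((2 * Real.pi) ^ (-(d : ℝ) / 2)))
  refine (hmain.congr_of_eventuallyEq ?_).congr_fderiv ?_
  · filter_upwards [hpos] with p hp
    unfold gaussianPdf
    have h2pi : (0 : ℝ) < 2 * Real.pi := by positivity
    rw [Real.log_mul (by positivity) (Real.exp_pos _).ne', Real.log_mul (by positivity)
      (by positivity), Real.log_exp, Real.log_rpow hp]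
    simp [add_assoc]
  · apply ContinuousLinearMap.ext
    rintro ⟨x, H⟩
    have hadj : (S.det)⁻¹ • S.adjugateᵀ = S⁻¹ := by
      rw [← hWsym, Matrix.inv_def, Ring.inverse_eq_inv', transpose_smul]
    have hV : S⁻¹ * vecMulVec (θ - μ) (θ - μ) * S⁻¹
        = vecMulVec (S⁻¹ *ᵥ (θ - μ)) (S⁻¹ *ᵥ (θ - μ)) := by
      rw [mul_vecMulVec, vecMulVec_mul, ← mulVec_transpose, hWsym]
    have hswap : ∀ a b : Fin d → ℝ, a ⬝ᵥ S⁻¹ *ᵥ b = (S⁻¹ *ᵥ a) ⬝ᵥ b := by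
      intro a b
      rw [dotProduct_mulVec, ← mulVec_transpose, hWsym]
    rw [hV]
    have hLA' : LA (x, H) = H - vecMulVec x μ - vecMulVec μ x := hLA (x, H)
    have hLQ' : LQ (x, H) = (-x) ⬝ᵥ ((S + vecMulVec μ μ) - vecMulVec μ μ)⁻¹ *ᵥ (θ - μ) +
        (θ - μ) ⬝ᵥ LI (LA (x, H)) *ᵥ (θ - μ) +
        (θ - μ) ⬝ᵥ ((S + vecMulVec μ μ) - vecMulVec μ μ)⁻¹ *ᵥ (-x) := hLQ (x, H)
    change (-1 / 2) * ((((S + vecMulVec μ μ) - vecMulVec μ μ).det)⁻¹ *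
        matCLM S.adjugateᵀ (LA (x, H))) + -(1 / 2) * LQ (x, H) =
      (S⁻¹ *ᵥ θ - vecMulVec (S⁻¹ *ᵥ (θ - μ)) (S⁻¹ *ᵥ (θ - μ)) *ᵥ μ) ⬝ᵥ x +
        matCLM (-(1 / 2 : ℝ) • (S⁻¹ - vecMulVec (S⁻¹ *ᵥ (θ - μ)) (S⁻¹ *ᵥ (θ - μ)))) H
    rw [hLQ', hLA', hLI, hval, matCLM_smul_left (-(1 / 2 : ℝ))]
    rw [← matCLM_smul_left S.det⁻¹, hadj]
    set v := S⁻¹ *ᵥ (θ - μ) with hv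
    have hq : (θ - μ) ⬝ᵥ -(S⁻¹ * (H - vecMulVec x μ - vecMulVec μ x) * S⁻¹) *ᵥ (θ - μ)
        = - matCLM (vecMulVec v v) (H - vecMulVec x μ - vecMulVec μ x) := by
      rw [matCLM_vecMulVec_left, neg_mulVec, dotProduct_neg, ← mulVec_mulVec, ← mulVec_mulVec,
        hswap]
    rw [hq]
    have e1 : S⁻¹ *ᵥ θ = v + S⁻¹ *ᵥ μ := by rw [hv, ← mulVec_add, sub_add_cancel]
    rw [e1]
    simp only [matCLM_sub_left, map_sub, matCLM_vecMulVec_right, hswap, mulVec_neg, ← hv,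
      vecMulVec_mulVec, sub_dotProduct, add_dotProduct, neg_dotProduct, dotProduct_neg,
      matCLM_vecMulVec_left]
    have e2 : S⁻¹ *ᵥ x ⬝ᵥ μ = S⁻¹ *ᵥ μ ⬝ᵥ x := by rw [← hswap x μ, dotProduct_comm]
    rw [e2]
    simp only [op_smul_eq_smul, dotProduct_smul, smul_dotProduct, smul_eq_mul]
    rw [dotProduct_comm x v, dotProduct_comm μ v]
    ring
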